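/- Let n ≥ 1 be an integer and let ζ_1,…,ζ_n be the Chebyshev nodes of the first kind in [−1,1]. Then for every x ∈ [−1,1], Σ_{k=1}^{n} | 1/n + (2/n)·Σ_{m=1}^{n−1} T_m(ζ_k)·T_m(x) | ≤ (2/π)·log(n) + 1. -/

import Mathlib

open Real Finset

/-- Chebyshev polynomial of the first kind of degree `m`, evaluated at `x`. -/
noncomputable def chebT (m : ℕ) (x : ℝ) : ℝ :=
  (Polynomial.Chebyshev.T ℝ m).eval x

/-- The `k`-th Chebyshev node of the first kind in `[-1, 1]` among `n` nodes,
for `1 ≤ k ≤ n`: `ζ_k = cos((2k−1)π/(2n))`. -/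
noncomputable def chebNode (n k : ℕ) : ℝ :=
  Real.cos ((2 * (k : ℝ) - 1) * Real.pi / (2 * (n : ℝ)))

/-- The Chebyshev basis polynomial on `[-1,1]`:
`φ(ζ_i, x) = 1/n + (2/n)·Σ_{m=1}^{n−1} T_m(ζ_i)·T_m(x)`. -/
noncomputable def chebBasis (n i : ℕ) (x : ℝ) : ℝ :=
  1 / (n : ℝ) + (2 / (n : ℝ)) *
    ∑ m ∈ Finset.Icc 1 (n - 1), chebT m (chebNode n i) * chebT m x

/-- The modified Dirichlet kernel `1 + 2 ∑_{0 < m < n} cos (m t) + cos (n t)`. -/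
noncomputable def modDirichlet (n : ℕ) (t : ℝ) : ℝ :=
  1 + 2 * ∑ m ∈ Finset.Icc 1 (n - 1), Real.cos (m * t) + Real.cos (n * t)

/-- The angle of the `k`-th Chebyshev node. -/
noncomputable def chebAngle (n k : ℕ) : ℝ :=
  (2 * (k : ℝ) - 1) * Real.pi / (2 * (n : ℝ))

/-- The sum of the absolute values of the modified Dirichlet kernel over all angles `θ ± θ_k`. -/
noncomputable def absKernelSum (n : ℕ) (θ : ℝ) : ℝ :=
  ∑ k ∈ Finset.Icc 1 n,
    (|modDirichlet n (θ - chebAngle n k)| + |modDirichlet n (θ + chebAngle n k)|)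

theorem modDirichlet_mul_sin {n : ℕ} (hn : 1 ≤ n) (u : ℝ) :
    modDirichlet n (2 * u) * Real.sin u = Real.sin (n * (2 * u)) * Real.cos u := by
  induction n, hn using Nat.le_induction with
  | base =>
    simp only [modDirichlet, Nat.sub_self, Nat.cast_one, one_mul, Real.cos_two_mul,
      Real.sin_two_mul]
    simp
    ring
  | succ n hn ih =>
    have hstep : modDirichlet (n + 1) (2 * u) = modDirichlet n (2 * u) +
        Real.cos (n * (2 * u)) + Real.cos (n * (2 * u) + 2 * u) := by
      obtain ⟨N, rfl⟩ : ∃ N, n = N + 1 := ⟨n - 1, by omega⟩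
      simp only [modDirichlet, Nat.add_sub_cancel]
      rw [Finset.sum_Icc_succ_top (by omega)]
      push_cast
      rw [show ((N : ℝ) + 1 + 1) * (2 * u) = (N + 1) * (2 * u) + 2 * u by ring]
      ring
    have h1 : ((n + 1 : ℕ) : ℝ) * (2 * u) = n * (2 * u) + 2 * u := by push_cast; ring
    rw [hstep, h1, add_mul, add_mul, ih, Real.sin_add, Real.cos_add, Real.cos_two_mul,
      Real.sin_two_mul]
    linear_combination -2 * Real.sin (n * (2 * u)) * Real.cos u * Real.sin_sq_add_cos_sq u

theorem modDirichlet_neg (n : ℕ) (t : ℝ) : modDirichlet n (-t) = modDirichlet n t := by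
  simp [modDirichlet, mul_neg, Real.cos_neg]

theorem modDirichlet_add_two_pi (n : ℕ) (t : ℝ) :
    modDirichlet n (t + 2 * Real.pi) = modDirichlet n t := by
  simp only [modDirichlet, mul_add, Real.cos_add_nat_mul_two_pi]

theorem continuous_modDirichlet (n : ℕ) : Continuous (modDirichlet n) := by
  unfold modDirichlet
  fun_prop

theorem cos_natCast_mul_chebAngle {n : ℕ} (hn : 1 ≤ n) (k : ℕ) :
    Real.cos (n * chebAngle n k) = 0 := by
  have hn0 : (n : ℝ) ≠ 0 := by positivity
  rw [Real.cos_eq_zero_iff]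
  refine ⟨(k : ℤ) - 1, ?_⟩
  unfold chebAngle
  push_cast
  field_simp
  ring

theorem chebBasis_cos {n : ℕ} (hn : 1 ≤ n) (k : ℕ) (θ : ℝ) :
    chebBasis n k (Real.cos θ) = 1 / (2 * n) *
      (modDirichlet n (θ - chebAngle n k) + modDirichlet n (θ + chebAngle n k)) := by
  have hn0 : (n : ℝ) ≠ 0 := by positivity
  have hT : ∀ (m : ℕ) (t : ℝ), chebT m (Real.cos t) = Real.cos (m * t) := by
    intro m t
    unfold chebT
    exact_mod_cast Polynomial.Chebyshev.T_real_cos t (m : ℤ)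
  have hnode : chebNode n k = Real.cos (chebAngle n k) := rfl
  have hsum : ∀ a b : ℝ, Real.cos (a - b) + Real.cos (a + b) = 2 * (Real.cos b * Real.cos a) := by
    intro a b
    rw [Real.cos_sub, Real.cos_add]
    ring
  have h1 : modDirichlet n (θ - chebAngle n k) + modDirichlet n (θ + chebAngle n k) =
      2 + 4 * ∑ m ∈ Finset.Icc 1 (n - 1),
        Real.cos (m * chebAngle n k) * Real.cos (m * θ) := by
    have h2 : ∑ m ∈ Finset.Icc 1 (n - 1), Real.cos (m * (θ - chebAngle n k)) +
        ∑ m ∈ Finset.Icc 1 (n - 1), Real.cos (m * (θ + chebAngle n k)) =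
        2 * ∑ m ∈ Finset.Icc 1 (n - 1), Real.cos (m * chebAngle n k) * Real.cos (m * θ) := by
      rw [← Finset.sum_add_distrib, Finset.mul_sum]
      refine Finset.sum_congr rfl fun m _ => ?_
      rw [mul_sub, mul_add, hsum]
    have h3 : Real.cos (n * (θ - chebAngle n k)) + Real.cos (n * (θ + chebAngle n k)) = 0 := by
      rw [mul_sub, mul_add, hsum, cos_natCast_mul_chebAngle hn]
      ring
    unfold modDirichlet
    linear_combination 2 * h2 + h3
  rw [h1]
  simp only [chebBasis, hnode, hT]
  generalize ∑ m ∈ Finset.Icc 1 (n - 1),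
    Real.cos (m * chebAngle n k) * Real.cos (m * θ) = S
  field_simp
  ring

theorem sum_abs_chebBasis_le {n : ℕ} (hn : 1 ≤ n) (θ : ℝ) :
    ∑ k ∈ Finset.Icc 1 n, |chebBasis n k (Real.cos θ)| ≤ 1 / (2 * n) * absKernelSum n θ := by
  rw [absKernelSum, Finset.mul_sum]
  refine Finset.sum_le_sum fun k _ => ?_
  rw [chebBasis_cos hn, abs_mul, abs_of_nonneg (by positivity : (0 : ℝ) ≤ 1 / (2 * n))]
  gcongr
  exact abs_add_le _ _

theorem absKernelSum_periodic {n : ℕ} (hn : 1 ≤ n) :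
    Function.Periodic (absKernelSum n) (Real.pi / n) := by
  intro θ
  have hn0 : (n : ℝ) ≠ 0 := by positivity
  set f : ℕ → ℝ := fun k => |modDirichlet n (θ - chebAngle n k)| with hf
  set g : ℕ → ℝ := fun k => |modDirichlet n (θ + chebAngle n k)| with hg
  have h1 : ∀ k ∈ Finset.range n,
      |modDirichlet n (θ + Real.pi / n - chebAngle n (k + 1))| +
        |modDirichlet n (θ + Real.pi / n + chebAngle n (k + 1))| = f k + g (k + 2) := by
    intro k _
    have e1 : θ + Real.pi / n - chebAngle n (k + 1) = θ - chebAngle n k := by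
      unfold chebAngle; push_cast; field_simp; ring
    have e2 : θ + Real.pi / n + chebAngle n (k + 1) = θ + chebAngle n (k + 2) := by
      unfold chebAngle; push_cast; field_simp; ring
    rw [e1, e2]
  have hfg : f 0 = g 1 := by
    have e : θ - chebAngle n 0 = θ + chebAngle n 1 := by
      unfold chebAngle; push_cast; field_simp; ring
    simp only [hf, hg, e]
  have hgf : g (n + 1) = f n := by
    have e : θ + chebAngle n (n + 1) = θ - chebAngle n n + 2 * Real.pi := by
      unfold chebAngle; push_cast; field_simp; ring
    simp only [hf, hg, e, modDirichlet_add_two_pi]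
  have hIcc : ∀ F : ℕ → ℝ, ∑ k ∈ Finset.Icc 1 n, F k = ∑ k ∈ Finset.range n, F (k + 1) := by
    intro F
    rw [Finset.range_eq_Ico, Finset.sum_Ico_add' F 0 n 1]
    rfl
  rw [absKernelSum, absKernelSum, hIcc, hIcc, Finset.sum_congr rfl h1,
    Finset.sum_add_distrib, Finset.sum_add_distrib]
  have hf' := Finset.sum_range_succ f n
  rw [Finset.sum_range_succ'] at hf'
  have hg' := Finset.sum_range_succ (fun k => g (k + 1)) n
  rw [Finset.sum_range_succ'] at hg'
  change _ = ∑ k ∈ Finset.range n, f (k + 1) + ∑ k ∈ Finset.range n, g (k + 1)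
  simp only [zero_add, add_assoc, Nat.reduceAdd] at hf' hg'
  linarith

theorem sin_natCast_mul_mul_sin_le {s a : ℝ} (hs : 0 ≤ s) (hsa : s ≤ a) (n : ℕ)
    (hna : n * a ≤ Real.pi / 2) :
    Real.sin (n * a) * Real.sin s ≤ Real.sin (n * s) * Real.sin a := by
  induction n with
  | zero => simp
  | succ n ih =>
    push_cast at hna ⊢
    have ha : 0 ≤ a := hs.trans hsa
    have hnn : 0 ≤ (n : ℝ) * a := by positivity
    have ha2 : a ≤ Real.pi / 2 := by nlinarith
    have hn2 : n * a ≤ Real.pi / 2 := by nlinarith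
    have hpi := Real.pi_pos
    have hns : (n : ℝ) * s ≤ n * a := by gcongr
    have hns0 : 0 ≤ (n : ℝ) * s := by positivity
    have h1 : Real.cos a ≤ Real.cos s := Real.cos_le_cos_of_nonneg_of_le_pi hs (by linarith) hsa
    have h2 : Real.cos (n * a) ≤ Real.cos (n * s) :=
      Real.cos_le_cos_of_nonneg_of_le_pi hns0 (by linarith) hns
    have h3 : 0 ≤ Real.sin s := Real.sin_nonneg_of_nonneg_of_le_pi hs (by linarith)
    have h4 : 0 ≤ Real.sin a := Real.sin_nonneg_of_nonneg_of_le_pi ha (by linarith)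
    have h5 : 0 ≤ Real.sin (n * a) := Real.sin_nonneg_of_nonneg_of_le_pi hnn (by linarith)
    have h6 : 0 ≤ Real.cos s := Real.cos_nonneg_of_mem_Icc ⟨by linarith, by linarith⟩
    rw [add_mul, add_mul, one_mul, one_mul, Real.sin_add, Real.sin_add]
    have i1 := mul_le_mul_of_nonneg_right (ih hn2) h6
    have i2 := mul_le_mul_of_nonneg_left h1 (mul_nonneg h5 h3)
    have i3 := mul_le_mul_of_nonneg_right h2 (mul_nonneg h3 h4)
    linarith

theorem sin_sq_le_of_abs_le {n : ℕ} (hn : 1 ≤ n) {s a : ℝ} (hs : |s| ≤ Real.pi / (4 * n))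
    (ha : Real.pi / (4 * n) ≤ a) (ha' : a ≤ Real.pi / 2) :
    Real.sin s ^ 2 ≤ 2 * Real.sin a ^ 2 * Real.sin (n * s) ^ 2 := by
  wlog h0 : 0 ≤ s generalizing s
  · have := this (s := -s) (by rwa [abs_neg]) (by linarith)
    simpa using this
  rw [abs_of_nonneg h0] at hs
  have hn0 : (n : ℝ) ≠ 0 := by positivity
  have hpi := Real.pi_pos
  set b := Real.pi / (4 * n) with hb
  have hb0 : 0 < b := by positivity
  have hnb : n * b = Real.pi / 4 := by rw [hb]; field_simp
  have h1 := sin_natCast_mul_mul_sin_le h0 hs n (by linarith)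
  rw [hnb, Real.sin_pi_div_four] at h1
  have hsin : Real.sin b ≤ Real.sin a :=
    Real.sin_le_sin_of_le_of_le_pi_div_two (by linarith) ha' ha
  have hs0 : 0 ≤ Real.sin s := Real.sin_nonneg_of_nonneg_of_le_pi h0 (by linarith)
  have hns : (n : ℝ) * s ≤ n * b := by gcongr
  have hns0 : 0 ≤ Real.sin (n * s) :=
    Real.sin_nonneg_of_nonneg_of_le_pi (by positivity) (by linarith)
  have h2 := h1.trans (mul_le_mul_of_nonneg_left hsin hns0)
  have h3 := pow_le_pow_left₀ (by positivity) h2 2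
  have h4 : (√2 : ℝ) ^ 2 = 2 := Real.sq_sqrt (by norm_num)
  simp only [mul_pow, div_pow, h4] at h3
  linarith

theorem cos_mul_cot_add_cot_le {n : ℕ} (hn : 1 ≤ n) {s a : ℝ} (hs : |s| < Real.pi / (4 * n))
    (ha : Real.pi / (4 * n) ≤ a) (ha' : a ≤ Real.pi / 2) :
    Real.cos (n * (2 * s)) * (Real.cos (a - s) / Real.sin (a - s) +
      Real.cos (a + s) / Real.sin (a + s)) ≤ 2 * (Real.cos a / Real.sin a) := by
  have hpi := Real.pi_pos
  have hn1 : (1 : ℝ) ≤ n := by exact_mod_cast hn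
  have hle : Real.pi / (4 * n) ≤ Real.pi / 4 := by
    apply div_le_div_of_nonneg_left <;> linarith
  obtain ⟨hs1, hs2⟩ := abs_lt.mp hs
  have hp : 0 < Real.sin (a + s) := Real.sin_pos_of_pos_of_lt_pi (by linarith) (by linarith)
  have hm : 0 < Real.sin (a - s) := Real.sin_pos_of_pos_of_lt_pi (by linarith) (by linarith)
  have hsa : 0 < Real.sin a := Real.sin_pos_of_pos_of_lt_pi (by linarith) (by linarith)
  have hca : 0 ≤ Real.cos a := Real.cos_nonneg_of_mem_Icc ⟨by linarith, by linarith⟩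
  have hsum : Real.cos (a - s) / Real.sin (a - s) + Real.cos (a + s) / Real.sin (a + s) =
      2 * Real.sin a * Real.cos a / (Real.sin (a - s) * Real.sin (a + s)) := by
    rw [div_add_div _ _ hm.ne' hp.ne']
    congr 1
    rw [← Real.sin_two_mul, show 2 * a = (a - s) + (a + s) by ring, Real.sin_add (a - s)]
    ring
  have hprod : Real.sin (a - s) * Real.sin (a + s) = Real.sin a ^ 2 - Real.sin s ^ 2 := by
    rw [Real.sin_add, Real.sin_sub]
    linear_combination Real.sin a ^ 2 * Real.sin_sq_add_cos_sq s -
      Real.sin s ^ 2 * Real.sin_sq_add_cos_sq a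
  have hkey := sin_sq_le_of_abs_le hn hs.le ha ha'
  have hcos : Real.cos (n * (2 * s)) = 1 - 2 * Real.sin (n * s) ^ 2 := by
    rw [show (n : ℝ) * (2 * s) = 2 * (n * s) by ring, Real.cos_two_mul, Real.cos_sq']
    ring
  rw [hsum, ← mul_div_assoc, ← mul_div_assoc, div_le_div_iff₀ (by positivity) hsa, hprod, hcos]
  nlinarith [mul_nonneg hca (sub_nonneg.mpr hkey)]

theorem mul_cos_le_sin {x : ℝ} (hx : 0 ≤ x) (hx' : x ≤ Real.pi / 2) :
    x * Real.cos x ≤ Real.sin x := by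
  rcases hx'.eq_or_lt with rfl | h
  · simp
  · have hc : 0 < Real.cos x := Real.cos_pos_of_mem_Ioo ⟨by linarith [Real.pi_pos], h⟩
    have := Real.le_tan hx h
    rwa [Real.tan_eq_sin_div_cos, le_div_iff₀ hc] at this

theorem cos_div_sin_le {x : ℝ} (hx : 0 < x) (hx' : x ≤ Real.pi / 2) :
    Real.cos x / Real.sin x ≤ 1 / x - x / 3 := by
  have hmono : MonotoneOn (fun y => (1 - y ^ 2 / 3) * Real.sin y - y * Real.cos y)
      (Set.Icc 0 (Real.pi / 2)) := by
    have hd : ∀ y : ℝ, HasDerivAt (fun y => (1 - y ^ 2 / 3) * Real.sin y - y * Real.cos y)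
        (y / 3 * (Real.sin y - y * Real.cos y)) y := by
      intro y
      have h1 : HasDerivAt (fun y : ℝ => 1 - y ^ 2 / 3) (-(2 * y / 3)) y := by
        simpa using ((hasDerivAt_pow 2 y).div_const 3).const_sub 1
      refine ((h1.mul (Real.hasDerivAt_sin y)).sub
        ((hasDerivAt_id y).mul (Real.hasDerivAt_cos y))).congr_deriv ?_
      simp only [id]
      ring
    refine monotoneOn_of_hasDerivWithinAt_nonneg (convex_Icc _ _)
      (by fun_prop) (fun y _ => (hd y).hasDerivWithinAt) fun y hy => ?_
    rw [interior_Icc] at hy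
    have := mul_cos_le_sin hy.1.le hy.2.le
    exact mul_nonneg (by linarith [hy.1]) (by linarith)
  have h := hmono ⟨le_rfl, hx.le.trans hx'⟩ ⟨hx.le, hx'⟩ hx.le
  have hs : 0 < Real.sin x := Real.sin_pos_of_pos_of_lt_pi hx (by linarith [Real.pi_pos])
  simp only [Real.sin_zero, mul_zero, zero_mul, sub_zero] at h
  rw [div_le_iff₀ hs]
  have e : (1 / x - x / 3) * Real.sin x = ((1 - x ^ 2 / 3) * Real.sin x) / x := by
    field_simp
  rw [e, le_div_iff₀ hx]
  linarith

theorem abs_modDirichlet_add_abs_modDirichlet_le {n k : ℕ} (hk : k ∈ Finset.Icc 1 n) {s : ℝ}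
    (hs : |s| < Real.pi / (4 * n)) :
    |modDirichlet n (2 * s - chebAngle n k)| + |modDirichlet n (2 * s + chebAngle n k)| ≤
      2 * (1 / (chebAngle n k / 2) - chebAngle n k / 2 / 3) := by
  obtain ⟨hk1, hkn⟩ := Finset.mem_Icc.mp hk
  have hn : 1 ≤ n := hk1.trans hkn
  have hn0 : (0 : ℝ) < n := by positivity
  have hk1' : (1 : ℝ) ≤ k := by exact_mod_cast hk1
  have hkn' : (k : ℝ) ≤ n := by exact_mod_cast hkn
  have hpi := Real.pi_pos
  have hcosn := cos_natCast_mul_chebAngle hn k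
  obtain ⟨a, ha⟩ : ∃ a, chebAngle n k = 2 * a := ⟨chebAngle n k / 2, by ring⟩
  have ha1 : Real.pi / (4 * n) ≤ a := by
    have : a = (2 * k - 1) * (Real.pi / (4 * n)) := by
      have h := ha.symm
      unfold chebAngle at h
      field_simp at h ⊢
      linarith
    rw [this]
    exact le_mul_of_one_le_left (by positivity) (by linarith)
  have ha2 : a + Real.pi / (4 * n) ≤ Real.pi / 2 := by
    have h := ha.symm
    unfold chebAngle at h
    field_simp at h ⊢
    nlinarith
  have hb : 0 < Real.pi / (4 * n) := by positivity
  obtain ⟨hs1, hs2⟩ := abs_lt.mp hs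
  have hC : 0 ≤ Real.cos (n * (2 * s)) := by
    have e : (n : ℝ) * (Real.pi / (4 * n)) = Real.pi / 4 := by field_simp
    refine Real.cos_nonneg_of_mem_Icc ⟨?_, ?_⟩ <;> nlinarith
  rw [ha] at hcosn ⊢
  have bound : ∀ u : ℝ, 0 < a + u → a + u ≤ Real.pi / 2 →
      Real.cos (n * (2 * u)) = Real.cos (n * (2 * s)) →
      |modDirichlet n (2 * (a + u))| ≤
        Real.cos (n * (2 * s)) * (Real.cos (a + u) / Real.sin (a + u)) := by
    intro u hu hu' hcu
    have hsin : 0 < Real.sin (a + u) := Real.sin_pos_of_pos_of_lt_pi hu (by linarith)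
    have hcos : 0 ≤ Real.cos (a + u) := Real.cos_nonneg_of_mem_Icc ⟨by linarith, hu'⟩
    rw [← mul_div_assoc, le_div_iff₀ hsin]
    have h := congrArg abs (modDirichlet_mul_sin hn (a + u))
    rw [abs_mul, abs_mul, abs_of_pos hsin, abs_of_nonneg hcos] at h
    rw [h]
    gcongr
    rw [mul_add, mul_add, Real.sin_add, hcosn, zero_mul, add_zero, abs_mul, hcu,
      abs_of_nonneg hC]
    exact mul_le_of_le_one_left hC (Real.abs_sin_le_one _)
  have b1 := bound (-s) (by linarith) (by linarith) (by simp)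
  have b2 := bound s (by linarith) (by linarith) rfl
  have h3 := cos_mul_cot_add_cot_le hn hs ha1 (by linarith)
  have h4 := cos_div_sin_le (x := a) (by linarith) (by linarith)
  have e1 : |modDirichlet n (2 * s - 2 * a)| = |modDirichlet n (2 * (a + -s))| := by
    rw [← modDirichlet_neg, show -(2 * s - 2 * a) = 2 * (a + -s) by ring]
  have e2 : 2 * s + 2 * a = 2 * (a + s) := by ring
  have e3 : 2 * a / 2 = a := by ring
  rw [e1, e2, e3]
  rw [← sub_eq_add_neg] at b1 ⊢
  linarith

theorem absKernelSum_le {n : ℕ} (hn : 1 ≤ n) (θ : ℝ) :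
    absKernelSum n θ ≤
      ∑ k ∈ Finset.Icc 1 n, 2 * (1 / (chebAngle n k / 2) - chebAngle n k / 2 / 3) := by
  have hn0 : (0 : ℝ) < n := by positivity
  have hpi := Real.pi_pos
  set b := Real.pi / (2 * n) with hb
  have hb0 : 0 < b := by positivity
  have hopen : Set.Ioo (-b) b ⊆ {t | absKernelSum n t ≤
      ∑ k ∈ Finset.Icc 1 n, 2 * (1 / (chebAngle n k / 2) - chebAngle n k / 2 / 3)} := by
    intro t ht
    rw [Set.mem_ofPred_eq, absKernelSum]
    refine Finset.sum_le_sum fun k hk => ?_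
    have hb2 : Real.pi / (4 * n) = b / 2 := by rw [hb]; field_simp; norm_num
    have habs : |t / 2| < Real.pi / (4 * n) := by
      rw [hb2, abs_lt]
      constructor <;> linarith [ht.1, ht.2]
    have h := abs_modDirichlet_add_abs_modDirichlet_le hk habs
    rwa [show 2 * (t / 2) = t by ring] at h
  have hcont : Continuous (absKernelSum n) := by
    have := continuous_modDirichlet n
    unfold absKernelSum
    fun_prop
  have hclosed := closure_minimal hopen (isClosed_le hcont continuous_const)
  rw [closure_Ioo (by linarith)] at hclosed
  obtain ⟨y, hy, hyeq⟩ := (absKernelSum_periodic hn).exists_mem_Ico (by positivity) θ (-b)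
  rw [hyeq]
  refine hclosed ⟨hy.1, ?_⟩
  have : -b + Real.pi / n = b := by rw [hb]; field_simp; norm_num
  linarith [hy.2]

theorem sum_odd_inv_le {n : ℕ} (hn : 2 ≤ n) :
    2 * ∑ k ∈ Finset.Icc 1 n, 1 / (2 * (k : ℝ) - 1) ≤ Real.log n + 8 / 3 - Real.log 2 := by
  induction n, hn using Nat.le_induction with
  | base =>
    rw [show Finset.Icc 1 2 = {1, 2} from rfl, Finset.sum_pair (by norm_num)]
    norm_num
  | succ n hn ih =>
    rw [Finset.sum_Icc_succ_top (by omega)]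
    have hn0 : (0 : ℝ) < n := by positivity
    have hlog : 2 / (2 * (n : ℝ) + 1) ≤ Real.log (n + 1) - Real.log n := by
      rw [← Real.log_div (by positivity) (by positivity)]
      have h := Real.le_log_one_add_of_nonneg (x := 1 / (n : ℝ)) (by positivity)
      have e1 : 2 * (1 / (n : ℝ)) / (1 / n + 2) = 2 / (2 * n + 1) := by
        field_simp
        ring
      have e2 : 1 + 1 / (n : ℝ) = (n + 1) / n := by field_simp
      rwa [e1, e2] at h
    push_cast
    have e : 2 * (1 / (2 * ((n : ℝ) + 1) - 1)) = 2 / (2 * n + 1) := by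
      rw [show 2 * ((n : ℝ) + 1) - 1 = 2 * n + 1 by ring]
      ring
    linarith

theorem sum_odd (n : ℕ) : ∑ k ∈ Finset.Icc 1 n, (2 * (k : ℝ) - 1) = (n : ℝ) ^ 2 := by
  induction n with
  | zero => simp
  | succ n ih =>
    rw [Finset.sum_Icc_succ_top (by omega), ih]
    push_cast
    ring

/-- Lemma 2.1 of the paper: for `x ∈ [−1,1]`,
`Σ_{k=1}^{n} |φ(ζ_k, x)| ≤ (2/π)·log(n) + 1`. -/
theorem cheb_basis_abs_sum_le (n : ℕ) (hn : 1 ≤ n)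
    (x : ℝ) (hx : x ∈ Set.Icc (-1 : ℝ) 1) :
    ∑ k ∈ Finset.Icc 1 n, |chebBasis n k x| ≤
      (2 / Real.pi) * Real.log n + 1 := by
  rcases hn.eq_or_lt with rfl | hn2
  · simp [chebBasis]
  have hn0 : (0 : ℝ) < n := by positivity
  have hpi := Real.pi_pos
  rw [← Real.cos_arccos hx.1 hx.2]
  refine (sum_abs_chebBasis_le hn _).trans ?_
  refine (mul_le_mul_of_nonneg_left (absKernelSum_le hn _) (by positivity)).trans ?_
  have hterm : ∀ k ∈ Finset.Icc 1 n,
      2 * (1 / (chebAngle n k / 2) - chebAngle n k / 2 / 3) =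
        8 * n / Real.pi * (1 / (2 * (k : ℝ) - 1)) - Real.pi / (6 * n) * (2 * (k : ℝ) - 1) := by
    intro k hk
    have hk1 : (1 : ℝ) ≤ k := by exact_mod_cast (Finset.mem_Icc.mp hk).1
    have hk0 : 2 * (k : ℝ) - 1 ≠ 0 := by linarith
    unfold chebAngle
    field_simp
    ring
  rw [Finset.sum_congr rfl hterm, Finset.sum_sub_distrib, ← Finset.mul_sum, ← Finset.mul_sum,
    sum_odd]
  have h := sum_odd_inv_le hn2
  set S := ∑ k ∈ Finset.Icc 1 n, 1 / (2 * (k : ℝ) - 1)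
  have e : 1 / (2 * (n : ℝ)) * (8 * n / Real.pi * S - Real.pi / (6 * n) * (n : ℝ) ^ 2) =
      (2 * (2 * S) - Real.pi ^ 2 / 12) / Real.pi := by
    field_simp
    ring
  have e2 : 2 / Real.pi * Real.log n + 1 = (2 * Real.log n + Real.pi) / Real.pi := by
    field_simp
  rw [e, e2]
  gcongr
  nlinarith [Real.pi_gt_d2, Real.log_two_gt_d9]
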